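/- Let 0 ≤ a < b with b > 4. Then PGL₂(ℂ) acts almost freely on the Grassmannian G(a, P(V_b)) of a-planes in P(V_b): the stabilizer in PGL₂(ℂ) of a general a-plane in P(V_b) is trivial. -/

import Mathlib

set_option synthInstance.maxHeartbeats 1000000
set_option maxHeartbeats 1000000
noncomputable section
open MvPolynomial

abbrev SL2 := Matrix.SpecialLinearGroup (Fin 2) ℂ

/-- The action of `SL₂(ℂ)` on binary forms by linear substitution of the variables. -/
def sub1 (g : SL2) : MvPolynomial (Fin 2) ℂ →ₐ[ℂ] MvPolynomial (Fin 2) ℂ :=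
  aeval fun i => ∑ j, C (g.1 i j) * X j

theorem comb6 : ∀ S : Fin 6 → Bool, ∀ e2 e3 e4 e5 : Bool,
   ((e2 && e3) = false) → ((e2 && e5) = false) → ((e3 && e4) = false) → ((e3 && e5) = false) → ((e4 && e5) = false) →
   (∃ i, S i = true) → (∃ i, S i = false) →
   3 ≤ (Finset.univ.filter fun p : Fin 6 × Fin 6 => S p.1 = true ∧ S p.2 = false ∧
     (![true,false,e2,e3,e4,e5] : Fin 6 → Bool) ⟨max p.1.1 p.2.1 - min p.1.1 p.2.1, by omega⟩ = false).card := by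
  decide +kernel

theorem exists_rel {σ τ : Type} [Fintype σ] [Fintype τ] (h : Fintype.card σ < Fintype.card τ)
    (φ : τ → MvPolynomial σ ℂ) : ∃ F : MvPolynomial τ ℂ, F ≠ 0 ∧ aeval φ F = 0 := by
  by_contra hc
  push Not at hc
  have hi : AlgebraicIndependent ℂ φ := by
    rw [algebraicIndependent_iff]
    intro p hp
    by_contra h0
    exact hc p h0 hp
  have h1 := hi.lift_cardinalMk_le_trdeg
  rw [MvPolynomial.trdeg_of_isDomain] at h1
  simp at h1
  omega

theorem exists_cols {k n : ℕ} (M : Matrix (Fin k) (Fin n) ℂ) (N : Matrix (Fin n) (Fin k) ℂ)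
    (h : (M * N).det ≠ 0) : ∃ σ : Fin k → Fin n, (M.submatrix id σ).det ≠ 0 := by
  by_contra hc
  push Not at hc
  apply h
  rw [← Matrix.det_transpose]
  have : (M * N).transpose = fun i => ∑ j, N j i • M.transpose j := by
    ext i l
    simp [Matrix.mul_apply, Finset.sum_apply, mul_comm]
  rw [this]
  change Matrix.detRowAlternating (fun i => ∑ j, N j i • M.transpose j) = 0
  rw [← AlternatingMap.coe_multilinearMap, MultilinearMap.map_sum]
  apply Finset.sum_eq_zero
  intro r _
  rw [MultilinearMap.map_smul_univ]
  have := hc r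
  rw [← Matrix.det_transpose] at this
  have h2 : (Matrix.detRowAlternating (R := ℂ) (n := Fin k)) (fun i => M.transpose (r i)) = 0 := this
  simp [h2]

theorem poly_step (W : Submodule ℂ (Polynomial ℂ)) (m : ℕ) (h : Polynomial.degreeLT ℂ m ≤ W)
    (f : Polynomial ℂ) (hf : f ∈ W) (hd : f.natDegree = m) (h0 : f ≠ 0) :
    Polynomial.degreeLT ℂ (m+1) ≤ W := by
  intro p hp
  rw [Polynomial.mem_degreeLT, Polynomial.degree_lt_iff_coeff_zero] at hp
  have hl : f.coeff m ≠ 0 := by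
    rw [← hd]; simpa using h0
  have : p = (p - (p.coeff m / f.coeff m) • f) + (p.coeff m / f.coeff m) • f := by ring
  rw [this]
  refine W.add_mem (h ?_) (W.smul_mem _ hf)
  rw [Polynomial.mem_degreeLT, Polynomial.degree_lt_iff_coeff_zero]
  intro i hi
  rcases hi.eq_or_lt with rfl | hi
  · simp; field_simp; simp
  · have : f.coeff i = 0 := Polynomial.coeff_eq_zero_of_natDegree_lt (by omega)
    simp [this, hp i (by omega)]

theorem poly_inv (W : Submodule ℂ (Polynomial ℂ)) (μ : ℂ) (hμ : μ ≠ 0)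
    (hW : ∀ f ∈ W, Polynomial.taylor μ f ∈ W) (m : ℕ) :
    ∀ f ∈ W, f ≠ 0 → f.natDegree = m → Polynomial.degreeLT ℂ (m+1) ≤ W := by
  induction m with
  | zero =>
    intro f hf h0 hd
    refine poly_step W 0 ?_ f hf hd h0
    intro p hp
    rw [Polynomial.mem_degreeLT, Polynomial.degree_lt_iff_coeff_zero] at hp
    have : p = 0 := by ext i; simpa using hp i (by omega)
    simp [this]
  | succ m ih =>
    intro f hf h0 hd
    refine poly_step W (m+1) ?_ f hf hd h0
    have hl : f.coeff (m+1) ≠ 0 := by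
      rw [← hd]; simpa using h0
    have hc : (Polynomial.taylor μ f - f).coeff m ≠ 0 := by
      have : ((Polynomial.hasseDeriv m) f).natDegree < 2 := by
        have := Polynomial.natDegree_hasseDeriv_le f m
        omega
      rw [Polynomial.coeff_sub, Polynomial.taylor_coeff, Polynomial.eval_eq_sum_range' this]
      simp [Finset.sum_range_succ, Polynomial.hasseDeriv_coeff, add_comm 1 m]
      refine ⟨⟨?_, hl⟩, hμ⟩
      exact_mod_cast Nat.succ_ne_zero m
    have hz : Polynomial.taylor μ f - f ≠ 0 := fun h => hc (by simp [h])
    refine ih (Polynomial.taylor μ f - f) (W.sub_mem (hW f hf) hf) hz ?_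
    refine le_antisymm ?_ (Polynomial.le_natDegree_of_ne_zero hc)
    rw [Polynomial.natDegree_le_iff_coeff_eq_zero]
    intro i hi
    rcases (Nat.succ_le_of_lt hi).eq_or_lt with rfl | hi
    · have := Polynomial.coeff_taylor_natDegree μ f
      rw [hd] at this
      rw [Polynomial.coeff_sub, Nat.succ_eq_add_one, this, Polynomial.leadingCoeff, hd, sub_self]
    · rw [Polynomial.coeff_sub, Polynomial.coeff_eq_zero_of_natDegree_lt,
        Polynomial.coeff_eq_zero_of_natDegree_lt (p := f)]
      · simp
      · omega
      · rw [Polynomial.natDegree_taylor]; omega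

theorem poly_bound (W : Submodule ℂ (Polynomial ℂ)) [FiniteDimensional ℂ W] (μ : ℂ) (hμ : μ ≠ 0)
    (hW : ∀ f ∈ W, Polynomial.taylor μ f ∈ W) (k : ℕ) (hk : Module.finrank ℂ W ≤ k)
    (f : Polynomial ℂ) (hf : f ∈ W) (i : ℕ) (hi : k ≤ i) : f.coeff i = 0 := by
  by_contra hc
  have h0 : f ≠ 0 := fun h => hc (by simp [h])
  have h1 := poly_inv W μ hμ hW _ f hf h0 rfl
  have h2 := Submodule.finrank_mono h1
  rw [(Polynomial.degreeLTEquiv ℂ _).finrank_eq] at h2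
  have := Polynomial.le_natDegree_of_ne_zero hc
  simp at h2
  omega

def frame {K : Type*} [CommRing K] (β : Bool) (x y : K) : Matrix (Fin 2) (Fin 2) K :=
  if β then !![1, x; y, 1] else !![y, 1; 1, x]

theorem normal_form (g : Matrix (Fin 2) (Fin 2) ℂ) (hdet : g.det = 1) (h1 : g ≠ 1) (h2 : g ≠ -1) :
    ∃ (β : Bool) (x y : ℂ) (d : Matrix (Fin 2) (Fin 2) ℂ), (frame β x y).det ≠ 0 ∧
      frame β x y * g = d * frame β x y ∧ d 0 1 = 0 ∧
      ((d 1 0 = 0 ∧ d 0 0 ≠ d 1 1) ∨ (d 1 0 ≠ 0 ∧ d 0 0 = d 1 1)) := by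
  obtain ⟨p, q, r, s, rfl⟩ : ∃ p q r s, g = !![p, q; r, s] :=
    ⟨g 0 0, g 0 1, g 1 0, g 1 1, by ext i j; fin_cases i <;> fin_cases j <;> rfl⟩
  have hd : p * s - q * r = 1 := by simpa [Matrix.det_fin_two] using hdet
  by_cases hr : r = 0
  · subst hr
    have hd : p * s = 1 := by simpa using hd
    by_cases hps : p = s
    · subst hps
      have hq : q ≠ 0 := by
        rintro rfl
        have : (p - 1) * (p + 1) = 0 := by linear_combination hd
        rcases mul_eq_zero.1 this with h | h
        · apply h1
          have : p = 1 := by linear_combination h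
          subst this; ext i j; fin_cases i <;> fin_cases j <;> simp
        · apply h2
          have : p = -1 := by linear_combination h
          subst this; ext i j; fin_cases i <;> fin_cases j <;> simp
      refine ⟨false, 0, 0, !![p, 0; q, p], ?_, ?_, ?_, ?_⟩
      · simp [frame, Matrix.det_fin_two]
      · ext i j; fin_cases i <;> fin_cases j <;> simp [frame]
      · simp
      · right; simp [hq]
    · have hps' : p - s ≠ 0 := sub_ne_zero.2 hps
      refine ⟨true, q / (p - s), 0, !![p, 0; 0, s], ?_, ?_, ?_, ?_⟩
      · simp [frame, Matrix.det_fin_two]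
      · ext i j; fin_cases i <;> fin_cases j <;> simp [frame]
        field_simp; ring
      · simp
      · left; simpa using hps
  · obtain ⟨w, hw, hw'⟩ : ∃ w, w * w = (p - s) ^ 2 + 4 * q * r ∧ (w ≠ 0 → s - p - w ≠ 0) := by
      obtain ⟨w, hw⟩ := IsAlgClosed.exists_eq_mul_self ((p - s) ^ 2 + 4 * q * r)
      by_cases h : s - p - w = 0
      · refine ⟨-w, by rw [hw]; ring, fun h0 h3 => h0 ?_⟩
        linear_combination (h - h3) / 2
      · exact ⟨w, hw.symm, fun _ => h⟩
    by_cases h0 : w = 0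
    · subst h0
      have hq : q = - (p - s) ^ 2 / (4 * r) := by
        field_simp
        linear_combination -hw
      refine ⟨true, (s - p) / (2 * r), 0, !![(s + p) / 2, 0; r, (s + p) / 2], ?_, ?_, ?_, ?_⟩
      · simp [frame, Matrix.det_fin_two]
      · subst hq
        ext i j; fin_cases i <;> fin_cases j <;> simp [frame] <;> field_simp <;> ring
      · simp
      · right; simp [hr]
    · have hw2 := hw' h0
      have hq : q = (w ^ 2 - (p - s) ^ 2) / (4 * r) := by
        field_simp
        linear_combination -hw
      refine ⟨true, (s - p + w) / (2 * r), (2 * r) / (s - p - w),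
        !![(s + p + w) / 2, 0; 0, (s + p - w) / 2], ?_, ?_, ?_, ?_⟩
      · simp [frame, Matrix.det_fin_two]
        intro h
        field_simp at h
        apply h0
        linear_combination -h / 2
      · subst hq
        ext i j; fin_cases i <;> fin_cases j <;> simp [frame] <;> field_simp <;> ring
      · simp
      · left; simp
        intro h; apply h0; linear_combination h / 2

def subM {K : Type*} [CommRing K] (h : Matrix (Fin 2) (Fin 2) K) :
    MvPolynomial (Fin 2) K →ₐ[K] MvPolynomial (Fin 2) K :=
  aeval fun i => ∑ j, C (h i j) * X j

theorem subM_subM (h h' : Matrix (Fin 2) (Fin 2) ℂ) (f : MvPolynomial (Fin 2) ℂ) :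
    subM h (subM h' f) = subM (h' * h) f := by
  have : (subM h).comp (subM h') = subM (h' * h) := by
    apply MvPolynomial.algHom_ext
    intro i
    simp [subM, Matrix.mul_apply, algHom_C, Fin.sum_univ_two, algebraMap_eq]
    ring
  rw [← this]; rfl

theorem subM_one (f : MvPolynomial (Fin 2) ℂ) : subM 1 f = f := by
  have : subM (1 : Matrix (Fin 2) (Fin 2) ℂ) = AlgHom.id ℂ _ := by
    apply MvPolynomial.algHom_ext
    intro i
    fin_cases i <;> simp [subM]
  rw [this]; rfl

theorem subM_hom (h : Matrix (Fin 2) (Fin 2) ℂ) (f : MvPolynomial (Fin 2) ℂ) (b : ℕ)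
    (hf : f.IsHomogeneous b) : (subM h f).IsHomogeneous b := by
  have h1 : ∀ i : Fin 2, (∑ j, C (h i j) * X j : MvPolynomial (Fin 2) ℂ).IsHomogeneous 1 := by
    intro i
    apply IsHomogeneous.sum
    intro j _
    simpa using (isHomogeneous_C _ (h i j)).mul (isHomogeneous_X ℂ j)
  have h2 := hf.aeval (fun i => ∑ j, C (h i j) * X j) h1
  rw [one_mul] at h2
  exact h2

def mon (b : ℕ) (i : Fin (b+1)) : Fin 2 →₀ ℕ := Finsupp.single 0 (i : ℕ) + Finsupp.single 1 (b - (i : ℕ))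

theorem monomial_mon (b : ℕ) (i : Fin (b+1)) (c : ℂ) :
    monomial (mon b i) c = c • (X 0 ^ (i : ℕ) * X 1 ^ (b - (i : ℕ))) := by
  rw [mon, monomial_eq, smul_eq_C_mul]
  congr 1
  rw [Finsupp.prod_fintype _ _ (by simp)]
  simp [Fin.prod_univ_two]

theorem coeff_mon (b : ℕ) (i j : Fin (b+1)) :
    coeff (mon b i) (X 0 ^ (j : ℕ) * X 1 ^ (b - (j : ℕ)) : MvPolynomial (Fin 2) ℂ) =
      if j = i then 1 else 0 := by
  have := monomial_mon b j 1
  rw [one_smul] at this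
  rw [← this, coeff_monomial]
  congr 1
  simp only [eq_iff_iff]
  constructor
  · intro h
    have := DFunLike.congr_fun h 0
    simp [mon] at this
    exact Fin.ext this
  · rintro rfl; rfl

theorem hom_expand (b : ℕ) (f : MvPolynomial (Fin 2) ℂ) (hf : f.IsHomogeneous b) :
    f = ∑ j : Fin (b+1), coeff (mon b j) f • (X 0 ^ (j : ℕ) * X 1 ^ (b - (j : ℕ))) := by
  ext m
  simp_rw [← monomial_mon, coeff_sum, coeff_monomial]
  by_cases hm : m 0 + m 1 = b
  · have e : m = mon b ⟨m 0, by omega⟩ := by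
      ext i; fin_cases i <;> simp [mon]; omega
    rw [Finset.sum_eq_single (⟨m 0, by omega⟩ : Fin (b+1))]
    · rw [if_pos e.symm, ← e]
    · intro j _ hj
      rw [if_neg]
      rintro rfl
      apply hj
      ext; simp [mon]
    · simp
  · rw [Finset.sum_eq_zero]
    · apply hf.coeff_eq_zero
      simpa [Finsupp.degree_eq_sum] using hm
    · intro j _
      rw [if_neg]
      rintro rfl
      apply hm
      simp [mon]; omega

def entry {K : Type*} [CommRing K] {k b : ℕ} (β : Bool) (x y : K)
    (M : Matrix (Fin k) (Fin (b+1)) K) (s : Fin k) (i : Fin (b+1)) : K :=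
  ∑ j : Fin (b+1), M s j *
    coeff (mon b i) (subM (frame β x y) (X 0 ^ (j : ℕ) * X 1 ^ (b - (j : ℕ))))

theorem entry_map {K L : Type*} [CommRing K] [CommRing L] (f : K →+* L) {k b : ℕ} (β : Bool)
    (x y : K) (M : Matrix (Fin k) (Fin (b+1)) K) (s : Fin k) (i : Fin (b+1)) :
    f (entry β x y M s i) = entry β (f x) (f y) (M.map f) s i := by
  simp only [entry, map_sum, map_mul, Matrix.map_apply]
  refine Finset.sum_congr rfl fun j _ => ?_
  congr 1
  rw [← coeff_map]
  congr 1
  cases β <;> simp [subM, frame]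

theorem bad_rel (k b : ℕ) (β : Bool) (σ : Fin k → Fin (b+1)) (R : Finset (Fin k × Fin (b+1)))
    (hR : k * k + R.card + 2 < k * (b+1)) :
    ∃ F : MvPolynomial (Fin k × Fin (b+1)) ℂ, F ≠ 0 ∧
      ∀ (x y : ℂ) (A : Matrix (Fin k) (Fin k) ℂ) (B : Matrix (Fin k) (Fin (b+1)) ℂ),
        (∀ t, B t (σ t) = 1) → (∀ t j, j ≠ σ t → (t, j) ∉ R → B t j = 0) →
        eval (fun p => entry β x y (A * B) p.1 p.2) F = 0 := by
  classical
  let τ := Fin 2 ⊕ (Fin k × Fin k) ⊕ {r // r ∈ R}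
  let A' : Matrix (Fin k) (Fin k) (MvPolynomial τ ℂ) := fun s t => X (Sum.inr (Sum.inl (s, t)))
  let B' : Matrix (Fin k) (Fin (b+1)) (MvPolynomial τ ℂ) := fun t j =>
    if j = σ t then 1 else if h : (t, j) ∈ R then X (Sum.inr (Sum.inr ⟨(t, j), h⟩)) else 0
  obtain ⟨F, hF, hF'⟩ := exists_rel (σ := τ) (τ := Fin k × Fin (b+1))
    (by simp [τ]; omega)
    (fun p => entry β (X (Sum.inl 0)) (X (Sum.inl 1)) (A' * B') p.1 p.2)
  refine ⟨F, hF, fun x y A B h1 h2 => ?_⟩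
  let pt : τ → ℂ := Sum.elim ![x, y] (Sum.elim (fun p => A p.1 p.2) (fun r => B r.1.1 r.1.2))
  have hA : A'.map (eval pt) = A := by
    ext s t; rw [Matrix.map_apply]; simp [A', pt]
  have hB : B'.map (eval pt) = B := by
    ext t j
    rw [Matrix.map_apply]
    simp only [B']
    split_ifs with h h'
    · rw [h, h1]; simp
    · simp [pt]
    · rw [h2 t j h h']; simp
  have := congrArg (eval pt) hF'
  rw [map_zero] at this
  rw [← this, aeval_def, algebraMap_eq, ← coe_eval₂Hom, ← RingHom.comp_apply]
  congr 1
  apply MvPolynomial.ringHom_ext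
  · intro r; simp
  · intro p
    simp [entry_map, hA, hB, pt, Matrix.map_mul]

theorem comb (k b : ℕ) (hk : 0 < k) (hkb : k < b + 1) (hb : 4 < b) (σ : Fin k → Fin (b+1))
    (hσ : Function.Injective σ) (D : Fin (b+1) → ℂ) (c q : ℂ) (hc : c ≠ 0) (hq : q ≠ 0)
    (hq1 : q ≠ 1) (hD : ∀ j, D j = c * q ^ (j : ℕ)) :
    ∃ R : Finset (Fin k × Fin (b+1)), k * k + R.card + 2 < k * (b+1) ∧
      ∀ t j, j ∉ Set.range σ → D j = D (σ t) → (t, j) ∈ R := by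
  classical
  let U : Finset (Fin k × Fin (b+1)) := Finset.univ.filter fun p => p.2 ∉ Set.range σ
  let R := U.filter fun p => D p.2 = D (σ p.1)
  let R' := U.filter fun p => ¬ D p.2 = D (σ p.1)
  have hU : U.card = k * (b + 1 - k) := by
    have : U = Finset.univ ×ˢ (Finset.univ.image σ)ᶜ := by
      ext p; simp [U]
    rw [this, Finset.card_product, Finset.card_compl, Finset.card_image_of_injective _ hσ]
    simp
  have hRR : R.card + R'.card = U.card := Finset.card_filter_add_card_filter_not _
  have h3 : 3 ≤ R'.card := by
    obtain ⟨i, hi, hi2⟩ : ∃ i : ℕ, i + 1 ≤ b ∧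
        ¬ ((∃ t, (σ t : ℕ) = i) ↔ (∃ t, (σ t : ℕ) = i + 1)) := by
      by_contra hcon
      push Not at hcon
      have hall : ∀ i, i ≤ b → ((∃ t, (σ t : ℕ) = 0) ↔ (∃ t, (σ t : ℕ) = i)) := by
        intro i
        induction i with
        | zero => intro _; rfl
        | succ i ih => intro h; rw [ih (by omega)]; exact hcon i h
      have h0 : ∃ t, (σ t : ℕ) = 0 := (hall _ (by have := (σ ⟨0, hk⟩).2; omega)).2 ⟨⟨0, hk⟩, rfl⟩
      have hsurj : Function.Surjective σ := by
        intro j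
        obtain ⟨t, ht⟩ := (hall j (by omega)).1 h0
        exact ⟨t, Fin.ext ht⟩
      have := Fintype.card_le_of_surjective σ hsurj
      simp at this
      omega
    obtain ⟨w, hw, hwi, hwi2⟩ : ∃ w, w + 5 ≤ b ∧ w ≤ i ∧ i + 1 ≤ w + 5 :=
      ⟨min i (b - 5), by omega, by omega, by omega⟩
    let em : Fin 6 → Fin (b+1) := fun l => ⟨w + l, by omega⟩
    let S : Fin 6 → Bool := fun l => decide (em l ∈ Set.range σ)
    have hS : ∀ m (h1 : w ≤ m) (h2 : m ≤ w + 5),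
        ((∃ t, (σ t : ℕ) = m) ↔ S ⟨m - w, by omega⟩ = true) := by
      intro m h1 h2
      simp only [S, em, decide_eq_true_eq, Set.mem_range]
      refine exists_congr fun t => ?_
      rw [Fin.ext_iff]
      simp only
      rw [Nat.add_sub_cancel' h1]
    rw [hS i hwi (by omega), hS (i+1) (by omega) hwi2] at hi2
    have hex : (∃ l, S l = true) ∧ (∃ l, S l = false) := by
      cases h : S ⟨i - w, by omega⟩ <;> cases h' : S ⟨i + 1 - w, by omega⟩
      · simp [h, h'] at hi2
      · exact ⟨⟨_, h'⟩, ⟨_, h⟩⟩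
      · exact ⟨⟨_, h⟩, ⟨_, h'⟩⟩
      · simp [h, h'] at hi2
    have key := comb6 S (decide (q ^ 2 = 1)) (decide (q ^ 3 = 1)) (decide (q ^ 4 = 1))
      (decide (q ^ 5 = 1))
      (by
        simp only [Bool.and_eq_false_iff, decide_eq_false_iff_not, ← not_and_or]
        rintro ⟨h, h'⟩; exact hq1 (by linear_combination h' - q * h))
      (by
        simp only [Bool.and_eq_false_iff, decide_eq_false_iff_not, ← not_and_or]
        rintro ⟨h, h'⟩; exact hq1 (by linear_combination h' - (q * (q ^ 2 + 1)) * h))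
      (by
        simp only [Bool.and_eq_false_iff, decide_eq_false_iff_not, ← not_and_or]
        rintro ⟨h, h'⟩; exact hq1 (by linear_combination h' - q * h))
      (by
        simp only [Bool.and_eq_false_iff, decide_eq_false_iff_not, ← not_and_or]
        rintro ⟨h, h'⟩; exact hq1 (by linear_combination (q ^ 3 + 1) * h - q * h'))
      (by
        simp only [Bool.and_eq_false_iff, decide_eq_false_iff_not, ← not_and_or]
        rintro ⟨h, h'⟩; exact hq1 (by linear_combination h' - q * h))
      hex.1 hex.2
    refine key.trans ?_
    have : Nonempty (Fin k) := ⟨⟨0, hk⟩⟩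
    have hem : Function.Injective em := by
      intro l m h
      simp only [em, Fin.mk.injEq] at h
      exact Fin.ext (by omega)
    have hvec : ∀ d : Fin 6, (![true, false, decide (q ^ 2 = 1), decide (q ^ 3 = 1),
        decide (q ^ 4 = 1), decide (q ^ 5 = 1)] : Fin 6 → Bool) d = false → q ^ (d : ℕ) ≠ 1 := by
      intro d
      fin_cases d <;> simp [hq1]
    refine Finset.card_le_card_of_injOn (fun p => (Function.invFun σ (em p.1), em p.2)) ?_ ?_
    · intro p hp
      simp only [Finset.coe_filter, Finset.mem_univ, true_and, Set.mem_ofPred_eq] at hp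
      obtain ⟨h1, h2, h3⟩ := hp
      have h1 : em p.1 ∈ Set.range σ := by simpa [S] using h1
      have h2 : em p.2 ∉ Set.range σ := by simpa [S] using h2
      have h4 := hvec _ h3
      simp only [R', U, Finset.coe_filter, Finset.mem_filter, Finset.mem_univ, true_and,
        Set.mem_ofPred_eq]
      refine ⟨h2, ?_⟩
      rw [Function.invFun_eq h1, hD, hD]
      intro h5
      apply h4
      have h6 := mul_left_cancel₀ hc h5
      simp only [em, pow_add] at h6
      have h7 := mul_left_cancel₀ (pow_ne_zero w hq) h6
      simp only
      rcases le_total p.1.1 p.2.1 with h | h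
      · rw [max_eq_right h, min_eq_left h, pow_sub₀ _ hq h, h7]
        exact mul_inv_cancel₀ (pow_ne_zero _ hq)
      · rw [max_eq_left h, min_eq_right h, pow_sub₀ _ hq h, h7]
        exact mul_inv_cancel₀ (pow_ne_zero _ hq)
    · intro p hp p' hp' h
      simp only [Finset.coe_filter, Finset.mem_univ, true_and, Set.mem_ofPred_eq] at hp hp'
      have h1 : em p.1 ∈ Set.range σ := by simpa [S] using hp.1
      have h1' : em p'.1 ∈ Set.range σ := by simpa [S] using hp'.1
      simp only [Prod.mk.injEq] at h
      refine Prod.ext (hem ?_) (hem h.2)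
      rw [← Function.invFun_eq h1, h.1, Function.invFun_eq h1']
  refine ⟨R, ?_, ?_⟩
  · obtain ⟨e, he⟩ : ∃ e, b + 1 = k + e := ⟨b + 1 - k, by omega⟩
    have he' : b + 1 - k = e := by omega
    rw [he'] at hU
    have hm : k * (b + 1) = k * k + k * e := by rw [he, mul_add]
    omega
  · intro t j hj h
    simpa [R, U, h] using hj

theorem unip (k b : ℕ) (Q : Fin k → MvPolynomial (Fin 2) ℂ) (hQ : ∀ s, (Q s).IsHomogeneous b)
    (d : Matrix (Fin 2) (Fin 2) ℂ) (h01 : d 0 1 = 0) (h10 : d 1 0 ≠ 0) (h00 : d 0 0 ≠ 0)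
    (he : d 0 0 = d 1 1) (T : Matrix (Fin k) (Fin k) ℂ)
    (hT : ∀ s, subM d (Q s) = ∑ t, T s t • Q t) (s : Fin k) (j : Fin (b+1)) (hj : k ≤ b - j) :
    coeff (mon b j) (Q s) = 0 := by
  let ψ : MvPolynomial (Fin 2) ℂ →ₐ[ℂ] Polynomial ℂ := aeval ![1, Polynomial.X]
  have hψ : ∀ s, ψ (Q s) = ∑ j : Fin (b+1), coeff (mon b j) (Q s) • Polynomial.X ^ (b - (j : ℕ)) := by
    intro s
    conv_lhs => rw [hom_expand b _ (hQ s)]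
    simp [ψ]
  have htay : ∀ s, Polynomial.taylor (d 1 0 / d 0 0) (ψ (Q s)) =
      ((d 0 0) ^ b)⁻¹ • ψ (subM d (Q s)) := by
    intro s
    rw [hψ]
    conv_rhs => rw [hom_expand b _ (hQ s)]
    simp only [map_sum, map_smul, Finset.smul_sum]
    refine Finset.sum_congr rfl fun j _ => ?_
    rw [smul_comm]
    congr 1
    have e1 : ψ (subM d (X 0)) = Polynomial.C (d 0 0) := by
      simp [subM, ψ, Fin.sum_univ_two, h01, algHom_C]
    have e2 : ψ (subM d (X 1)) = Polynomial.C (d 0 0) * (Polynomial.X + Polynomial.C (d 1 0 / d 0 0)) := by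
      rw [mul_add, ← Polynomial.C_mul, mul_div_cancel₀ _ h00]
      simp [subM, ψ, Fin.sum_univ_two, ← he, algHom_C]
      ring
    rw [map_mul, map_mul, map_pow (subM d), map_pow ψ, map_pow (subM d), map_pow ψ, e1, e2, mul_pow, ← mul_assoc,
      ← pow_add, Nat.add_sub_cancel' (by omega), ← Polynomial.C_pow, Polynomial.taylor_apply,
      ← Polynomial.smul_eq_C_mul, smul_smul, inv_mul_cancel₀ (pow_ne_zero _ h00), one_smul]
    simp
  let W := Submodule.span ℂ (Set.range fun s => ψ (Q s))
  have hW : ∀ f ∈ W, Polynomial.taylor (d 1 0 / d 0 0) f ∈ W := by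
    intro f hf
    induction hf using Submodule.span_induction with
    | mem f hf =>
      obtain ⟨s, rfl⟩ := hf
      simp only
      rw [htay, hT, map_sum]
      refine W.smul_mem _ (W.sum_mem fun t _ => ?_)
      rw [map_smul]
      exact W.smul_mem _ (Submodule.subset_span ⟨t, rfl⟩)
    | zero => simp
    | add f g _ _ h1 h2 => rw [map_add]; exact W.add_mem h1 h2
    | smul c f _ h1 => rw [map_smul]; exact W.smul_mem _ h1
  have hfd : FiniteDimensional ℂ W := FiniteDimensional.span_of_finite ℂ (Set.finite_range _)
  have hfin : Module.finrank ℂ W ≤ k := by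
    simpa [Set.finrank] using finrank_range_le_card (R := ℂ) (fun s => ψ (Q s))
  have := poly_bound W (d 1 0 / d 0 0) (div_ne_zero h10 h00) hW k hfin (ψ (Q s))
    (Submodule.subset_span ⟨s, rfl⟩) (b - j) hj
  rw [hψ] at this
  simp only [Polynomial.finsetSum_coeff, Polynomial.coeff_smul, Polynomial.coeff_X_pow] at this
  rw [Finset.sum_eq_single j] at this
  · simpa using this
  · intro i _ hi
    rw [if_neg]
    · simp
    · intro h; apply hi; ext; omega
  · simp

theorem ss (k b : ℕ) (Q : Fin k → MvPolynomial (Fin 2) ℂ) (hQ : ∀ s, (Q s).IsHomogeneous b)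
    (d : Matrix (Fin 2) (Fin 2) ℂ) (h01 : d 0 1 = 0) (h10 : d 1 0 = 0) (T : Matrix (Fin k) (Fin k) ℂ)
    (hT : ∀ s, subM d (Q s) = ∑ t, T s t • Q t) (s : Fin k) (j : Fin (b+1)) :
    coeff (mon b j) (Q s) * (d 0 0 ^ (j : ℕ) * d 1 1 ^ (b - (j : ℕ))) =
      ∑ t, T s t * coeff (mon b j) (Q t) := by
  have h := congrArg (coeff (mon b j)) (hT s)
  rw [coeff_sum] at h
  simp only [coeff_smul, smul_eq_mul] at h
  rw [← h]
  conv_rhs => rw [hom_expand b _ (hQ s)]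
  have e : ∀ i : Fin (b+1), subM d (X 0 ^ (i : ℕ) * X 1 ^ (b - (i : ℕ))) =
      (d 0 0 ^ (i : ℕ) * d 1 1 ^ (b - (i : ℕ))) • (X 0 ^ (i : ℕ) * X 1 ^ (b - (i : ℕ))) := by
    intro i
    simp [subM, h01, h10, mul_pow, smul_eq_C_mul]
    ring
  simp only [map_sum, map_smul, coeff_sum, coeff_smul, e, coeff_mon, smul_eq_mul]
  simp

theorem core (k b : ℕ) (hk : 0 < k) (hkb : k < b + 1) (hb : 4 < b)
    (P : Fin k → MvPolynomial (Fin 2) ℂ) (hP : ∀ s, (P s).IsHomogeneous b)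
    (hdet : (Matrix.of fun s t : Fin k => coeff (mon b (Fin.castLE hkb.le t)) (P s)).det ≠ 0)
    (g : Matrix (Fin 2) (Fin 2) ℂ) (hg : g.det = 1) (h1 : g ≠ 1) (h2 : g ≠ -1)
    (hinv : ∀ s, subM g (P s) ∈ Submodule.span ℂ (Set.range P)) :
    ∃ (β : Bool) (σ : Fin k → Fin (b+1)) (R : Finset (Fin k × Fin (b+1))),
      k * k + R.card + 2 < k * (b+1) ∧
      ∃ (x y : ℂ) (A : Matrix (Fin k) (Fin k) ℂ) (B : Matrix (Fin k) (Fin (b+1)) ℂ),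
        (∀ t, B t (σ t) = 1) ∧ (∀ t j, j ≠ σ t → (t, j) ∉ R → B t j = 0) ∧
        ∀ s i, coeff (mon b i) (P s) = entry β x y (A * B) s i := by
  obtain ⟨β, x, y, d, hH, hHg, h01, hcase⟩ := normal_form g hg h1 h2
  have hHu : IsUnit (frame β x y).det := isUnit_iff_ne_zero.2 hH
  generalize hHdef : frame β x y = H at *
  have hd : d = H * g * H⁻¹ := by
    rw [hHg, Matrix.mul_assoc, Matrix.mul_nonsing_inv _ hHu, Matrix.mul_one]
  have hdd : d 0 0 * d 1 1 = 1 := by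
    have h := congrArg Matrix.det hHg
    rw [Matrix.det_mul, Matrix.det_mul, hg, mul_comm] at h
    have := mul_right_cancel₀ hH h
    rw [Matrix.det_fin_two, h01] at this
    rw [this]; ring
  have h00 : d 0 0 ≠ 0 := left_ne_zero_of_mul_eq_one hdd
  have h11 : d 1 1 ≠ 0 := right_ne_zero_of_mul_eq_one hdd
  let Q : Fin k → MvPolynomial (Fin 2) ℂ := fun s => subM H⁻¹ (P s)
  have hQ : ∀ s, (Q s).IsHomogeneous b := fun s => subM_hom _ _ _ (hP s)
  have hPQ : ∀ s, P s = subM H (Q s) := by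
    intro s
    simp only [Q]
    rw [subM_subM, Matrix.nonsing_inv_mul _ hHu, subM_one]
  obtain ⟨T, hT⟩ : ∃ T : Matrix (Fin k) (Fin k) ℂ, ∀ s, subM d (Q s) = ∑ t, T s t • Q t := by
    have : ∀ s, ∃ c : Fin k → ℂ, ∑ t, c t • P t = subM g (P s) := fun s =>
      (Submodule.mem_span_range_iff_exists_fun ℂ).1 (hinv s)
    choose T hT using this
    refine ⟨T, fun s => ?_⟩
    have h := congrArg (subM H⁻¹) (hT s)
    rw [map_sum] at h
    simp only [map_smul] at h
    rw [hPQ s, subM_subM, subM_subM, ← Matrix.mul_assoc, ← hd] at h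
    exact h.symm
  let M : Matrix (Fin k) (Fin (b+1)) ℂ := fun s j => coeff (mon b j) (Q s)
  let N : Matrix (Fin (b+1)) (Fin (b+1)) ℂ := fun j i =>
    coeff (mon b i) (subM H (X 0 ^ (j : ℕ) * X 1 ^ (b - (j : ℕ))))
  have hMN : ∀ s i, coeff (mon b i) (P s) = (M * N) s i := by
    intro s i
    rw [hPQ]
    conv_lhs => rw [hom_expand b _ (hQ s)]
    simp only [map_sum, map_smul, coeff_sum, coeff_smul, smul_eq_mul]
    rw [Matrix.mul_apply]
  obtain ⟨σ, hσdet⟩ := exists_cols M (N.submatrix id (Fin.castLE hkb.le)) (by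
    convert hdet using 2
    ext s t
    simp only [Matrix.of_apply, hMN]
    rfl)
  have hσ : Function.Injective σ := by
    intro t t' h
    by_contra hne
    exact hσdet (Matrix.det_zero_of_column_eq hne fun i => by simp [h])
  let A := M.submatrix id σ
  have hAu : IsUnit A.det := isUnit_iff_ne_zero.2 hσdet
  let B := A⁻¹ * M
  have hAB : A * B = M := by
    simp only [B]
    rw [← Matrix.mul_assoc, Matrix.mul_nonsing_inv _ hAu, Matrix.one_mul]
  have hBσ : ∀ t t', B t (σ t') = (1 : Matrix (Fin k) (Fin k) ℂ) t t' := by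
    intro t t'
    rw [← Matrix.nonsing_inv_mul _ hAu]
    rfl
  suffices hR : ∃ R : Finset (Fin k × Fin (b+1)), k * k + R.card + 2 < k * (b+1) ∧
      ∀ t j, j ∉ Set.range σ → (t, j) ∉ R → B t j = 0 by
    obtain ⟨R, hR1, hR2⟩ := hR
    refine ⟨β, σ, R, hR1, x, y, A, B, fun t => by simp [hBσ], ?_, ?_⟩
    · intro t j hj hjR
      by_cases h : j ∈ Set.range σ
      · obtain ⟨t', rfl⟩ := h
        rw [hBσ, Matrix.one_apply_ne]
        rintro rfl; exact hj rfl
      · exact hR2 t j h hjR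
    · intro s i
      rw [hMN, hAB, entry, hHdef, Matrix.mul_apply]
  rcases hcase with ⟨h10, hne⟩ | ⟨h10, heq⟩
  · let D : Fin (b+1) → ℂ := fun j => d 0 0 ^ (j : ℕ) * d 1 1 ^ (b - (j : ℕ))
    obtain ⟨R, hR1, hR2⟩ := comb k b hk hkb hb σ hσ D (d 1 1 ^ b) (d 0 0 / d 1 1)
      (pow_ne_zero _ h11) (div_ne_zero h00 h11) (by rwa [Ne, div_eq_one_iff_eq h11]) (by
        intro j
        simp only [D]
        have e : d 1 1 ^ b = d 1 1 ^ (b - (j : ℕ)) * d 1 1 ^ (j : ℕ) := by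
          rw [← pow_add, Nat.sub_add_cancel (by omega)]
        rw [div_pow, e]
        field_simp)
    refine ⟨R, hR1, fun t j hj hjR => ?_⟩
    have hMD : M * Matrix.diagonal D = T * M := by
      ext s j
      rw [Matrix.mul_diagonal, Matrix.mul_apply]
      exact ss k b Q hQ d h01 h10 T hT s j
    have hBD : B * Matrix.diagonal D = (A⁻¹ * T * A) * B := by
      rw [Matrix.mul_assoc _ A B, hAB, Matrix.mul_assoc A⁻¹ T M, ← hMD, ← Matrix.mul_assoc]
    have hC : A⁻¹ * T * A = Matrix.diagonal (fun t => D (σ t)) := by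
      ext t t'
      have := congrFun (congrFun hBD t) (σ t')
      rw [Matrix.mul_diagonal, hBσ, Matrix.mul_apply] at this
      simp only [hBσ, Matrix.one_apply, mul_ite, mul_one, mul_zero, Finset.sum_ite_eq',
        Finset.mem_univ, if_true] at this
      rw [← this, Matrix.diagonal_apply]
      by_cases h : t = t' <;> simp [h]
    have := congrFun (congrFun hBD t) j
    rw [hC, Matrix.mul_diagonal, Matrix.diagonal_mul] at this
    by_contra hB
    apply hjR (hR2 t j hj _)
    apply mul_left_cancel₀ hB
    rw [this, mul_comm]
  · have hz : ∀ (s : Fin k) (j : Fin (b+1)), k ≤ b - (j : ℕ) → M s j = 0 := fun s j hj =>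
      unip k b Q hQ d h01 h10 h00 heq T hT s j hj
    have hlt : ∀ t, b - (σ t : ℕ) < k := by
      intro t
      by_contra h
      exact hσdet (Matrix.det_eq_zero_of_column_eq_zero t fun s => hz s (σ t) (by omega))
    refine ⟨∅, ?_, ?_⟩
    · obtain ⟨e, he⟩ : ∃ e, b + 1 = k + e := ⟨b + 1 - k, by omega⟩
      rw [he, mul_add]
      have : 2 < k * e := by
        rcases Nat.lt_or_ge e 3 with h | h
        · have : 1 ≤ e := by omega
          nlinarith
        · nlinarith
      simp; omega
    · intro t j hj _
      have hjk : k ≤ b - (j : ℕ) := by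
        by_contra hcon
        have hinj : Function.Injective (fun o : Option (Fin k) =>
            (⟨b - ((o.elim j σ : Fin (b+1)) : ℕ), by cases o <;> simp <;> [omega; exact hlt _]⟩ : Fin k)) := by
          intro o o' h
          simp only [Fin.mk.injEq] at h
          have h' : (o.elim j σ : Fin (b+1)) = o'.elim j σ := Fin.ext (by omega)
          cases o <;> cases o' <;> simp at h' ⊢
          · exact hj ⟨_, h'.symm⟩
          · exact hj ⟨_, h'⟩
          · exact hσ h'
        have := Fintype.card_le_of_injective _ hinj
        simp at this
      simp only [B, Matrix.mul_apply]
      exact Finset.sum_eq_zero fun s _ => by rw [hz s j hjk, mul_zero]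

/-- **`PGL₂(ℂ)` acts almost freely on the Grassmannian `G(a, P(V_b))` for `0 ≤ a < b`,
`b > 4`.**  An `a`-plane in `P(V_b)` is the projectivization of the span of `a+1` binary
forms `P 0, …, P a` of degree `b`; "general" is expressed by the nonvanishing of some
nonzero polynomial `F` in the coefficients of the spanning forms (in the monomial basis
`X^i Y^(b-i)` of `V_b`).  The conclusion states that any `g ∈ SL₂(ℂ)` whose substitution
action preserves the span is `±1`, i.e. the stabilizer of a general `a`-plane in
`PGL₂(ℂ) = SL₂(ℂ)/{±1}` is trivial. -/
theorem PGL2_almost_free_on_grassmannian (a b : ℕ) (hab : a < b) (hb : 4 < b) :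
    ∃ F : MvPolynomial (Fin (a + 1) × Fin (b + 1)) ℂ, F ≠ 0 ∧
      ∀ P : Fin (a + 1) → MvPolynomial (Fin 2) ℂ,
        (∀ s, P s ∈ homogeneousSubmodule (Fin 2) ℂ b) →
        eval (fun p => coeff
            (Finsupp.single 0 ((p.2 : ℕ)) + Finsupp.single 1 (b - (p.2 : ℕ))) (P p.1)) F ≠ 0 →
        ∀ g : SL2,
          Submodule.map (sub1 g).toLinearMap (Submodule.span ℂ (Set.range P)) =
            Submodule.span ℂ (Set.range P) →
          g.1 = 1 ∨ g.1 = -1 := by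
  classical
  have hkb : a + 1 < b + 1 := by omega
  let G : Bool × (Fin (a+1) → Fin (b+1)) × Finset (Fin (a+1) × Fin (b+1)) →
      MvPolynomial (Fin (a + 1) × Fin (b + 1)) ℂ := fun x =>
    if h : (a+1) * (a+1) + x.2.2.card + 2 < (a+1) * (b+1) then
      (bad_rel (a+1) b x.1 x.2.1 x.2.2 h).choose else 1
  let F₀ : MvPolynomial (Fin (a + 1) × Fin (b + 1)) ℂ :=
    (Matrix.of fun s t : Fin (a+1) =>
      (X (s, Fin.castLE hkb.le t) : MvPolynomial (Fin (a + 1) × Fin (b + 1)) ℂ)).det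
  have hF₀ : ∀ v : Fin (a+1) × Fin (b+1) → ℂ, eval v F₀ =
      (Matrix.of fun s t : Fin (a+1) => v (s, Fin.castLE hkb.le t)).det := by
    intro v
    simp only [F₀]
    rw [RingHom.map_det]
    congr 1
    ext s t
    simp
  refine ⟨F₀ * ∏ x, G x, mul_ne_zero ?_ (Finset.prod_ne_zero_iff.2 fun x _ => ?_), ?_⟩
  · intro h
    have := hF₀ (fun p => if (p.1 : ℕ) = p.2 then 1 else 0)
    rw [h, map_zero] at this
    have e : (Matrix.of fun s t : Fin (a+1) =>
        (if (s : ℕ) = (Fin.castLE hkb.le t : Fin (b+1)) then 1 else 0 : ℂ)) = 1 := by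
      ext s t
      simp [Matrix.one_apply, Fin.ext_iff]
    simp only at this
    rw [e, Matrix.det_one] at this
    exact zero_ne_one this
  · simp only [G]
    split_ifs with h
    · exact (bad_rel (a+1) b x.1 x.2.1 x.2.2 h).choose_spec.1
    · exact one_ne_zero
  · intro P hP hF g hg
    by_contra hcon
    push Not at hcon
    rw [map_mul] at hF
    have h0 := left_ne_zero_of_mul hF
    have h1 := right_ne_zero_of_mul hF
    rw [hF₀] at h0
    rw [map_prod, Finset.prod_ne_zero_iff] at h1
    obtain ⟨β, σ, R, hR, x, y, A, B, hB1, hB2, hent⟩ := core (a+1) b (by omega) hkb hb P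
      (fun s => (mem_homogeneousSubmodule _ _).1 (hP s)) h0 g.1 g.2 hcon.1 hcon.2 (fun s => by
        have : (sub1 g).toLinearMap (P s) ∈
            Submodule.map (sub1 g).toLinearMap (Submodule.span ℂ (Set.range P)) :=
          Submodule.mem_map_of_mem (Submodule.subset_span ⟨s, rfl⟩)
        rw [hg] at this
        exact this)
    apply h1 (β, σ, R) (Finset.mem_univ _)
    simp only [G]
    rw [dif_pos hR]
    have hfin := (bad_rel (a+1) b β σ R hR).choose_spec.2 x y A B hB1 hB2
    have hfun : (fun p : Fin (a+1) × Fin (b+1) => entry β x y (A * B) p.1 p.2) =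
        fun p => coeff (Finsupp.single 0 ((p.2 : ℕ)) + Finsupp.single 1 (b - (p.2 : ℕ))) (P p.1) :=
      funext fun p => (hent p.1 p.2).symm
    rw [hfun] at hfin
    exact hfin
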